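/- Let f : B → A be a frame homomorphism and 𝒱 a covering uniformity on B. Then 𝒰 = {U | U is a covering downset on A and ↓f[V] ⊆ U for some V ∈ 𝒱} is a covering uniformity on A; each ↓f[V] for V ∈ 𝒱 belongs to 𝒰; and 𝒰 is the least covering uniformity on A with this property: any covering uniformity 𝒰' on A containing ↓f[V] for every V ∈ 𝒱 contains 𝒰. (Covering-uniformity instance of the proposition that pre-uniform locales are topological over overt locales: existence of initial lifts.) -/

import Mathlib

/-- A covering downset on a frame: a lower set whose supremum is the top element. -/
def IsCoveringDownset {L : Type*} [Order.Frame L] (C : Set L) : Prop :=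
  IsLowerSet C ∧ sSup C = ⊤

/-- The star of `a` with respect to `D`: the join of all members of `D` meeting `a`. -/
def frameStar {L : Type*} [Order.Frame L] (a : L) (D : Set L) : L :=
  sSup {u | u ∈ D ∧ a ⊓ u ≠ ⊥}

/-- `U⋆`: the lower closure of the set of stars of members of `U`. -/
def starCover {L : Type*} [Order.Frame L] (U : Set L) : Set L :=
  {x | ∃ u ∈ U, x ≤ frameStar u U}

/-- A covering uniformity on a frame. -/
def IsCoveringUniformity {L : Type*} [Order.Frame L] (𝒰 : Set (Set L)) : Prop :=
  𝒰.Nonempty ∧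
  (∀ U ∈ 𝒰, IsCoveringDownset U) ∧
  (∀ U ∈ 𝒰, ∀ U' : Set L, IsCoveringDownset U' → U ⊆ U' → U' ∈ 𝒰) ∧
  (∀ U ∈ 𝒰, ∀ V ∈ 𝒰, U ∩ V ∈ 𝒰) ∧
  (∀ U ∈ 𝒰, ∃ V ∈ 𝒰, starCover V ⊆ U)

/-- The uniformly below relation of a covering uniformity. -/
def UBelow {L : Type*} [Order.Frame L] (𝒰 : Set (Set L)) (a b : L) : Prop :=
  ∃ U ∈ 𝒰, frameStar a U ≤ b

/-- `↓f[S]`: the lower closure of the image of `S` under `f`. -/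
def imgDown {α β : Type*} [LE β] (f : α → β) (S : Set α) : Set β :=
  {b | ∃ s ∈ S, b ≤ f s}

theorem IsCoveringDownset.inter {L : Type*} [Order.Frame L] {U V : Set L}
    (hU : IsCoveringDownset U) (hV : IsCoveringDownset V) : IsCoveringDownset (U ∩ V) := by
  refine ⟨hU.1.inter hV.1, top_le_iff.mp ?_⟩
  calc (⊤ : L) = sSup U ⊓ sSup V := by rw [hU.2, hV.2, inf_top_eq]
    _ = ⨆ p ∈ U ×ˢ V, p.1 ⊓ p.2 := sSup_inf_sSup
    _ ≤ sSup (U ∩ V) := iSup₂_le fun _ hp =>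
      le_sSup ⟨hU.1 inf_le_left hp.1, hV.1 inf_le_right hp.2⟩

theorem imgDown_mono {α β : Type*} [LE β] (f : α → β) {S T : Set α} (h : S ⊆ T) :
    imgDown f S ⊆ imgDown f T :=
  fun _ ⟨s, hs, hb⟩ => ⟨s, h hs, hb⟩

theorem IsCoveringDownset.imgDown {A B : Type*} [Order.Frame A] [Order.Frame B]
    (f : FrameHom B A) {V : Set B} (hV : IsCoveringDownset V) :
    IsCoveringDownset (imgDown f V) := by
  refine ⟨fun _ _ hba ⟨s, hs, ha⟩ => ⟨s, hs, hba.trans ha⟩, top_le_iff.mp ?_⟩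
  rw [← map_top f, ← hV.2, map_sSup]
  exact sSup_le_sSup fun _ ⟨s, hs, h⟩ => ⟨s, hs, h.ge⟩

theorem frameStar_imgDown_le {A B : Type*} [Order.Frame A] [Order.Frame B]
    (f : FrameHom B A) (V : Set B) {a : A} {s : B} (ha : a ≤ f s) :
    frameStar a (imgDown f V) ≤ f (frameStar s V) := by
  refine sSup_le ?_
  rintro b ⟨⟨t, ht, hb⟩, hab⟩
  refine hb.trans (OrderHomClass.mono f (le_sSup ⟨ht, fun hst => hab ?_⟩))
  rw [← le_bot_iff, ← map_bot f, ← hst, map_inf]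
  exact inf_le_inf ha hb

theorem starCover_imgDown_subset {A B : Type*} [Order.Frame A] [Order.Frame B]
    (f : FrameHom B A) (V : Set B) :
    starCover (imgDown f V) ⊆ imgDown f (starCover V) :=
  fun _ ⟨_, ⟨s, hs, ha⟩, hx⟩ =>
    ⟨frameStar s V, ⟨s, hs, le_rfl⟩, hx.trans (frameStar_imgDown_le f V ha)⟩

theorem initial_uniformity_lift {A B : Type*} [Order.Frame A] [Order.Frame B]
    (f : FrameHom B A) (𝒱 : Set (Set B)) (h𝒱 : IsCoveringUniformity 𝒱)
    (𝒰 : Set (Set A))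
    (h𝒰 : 𝒰 = {U | IsCoveringDownset U ∧ ∃ V ∈ 𝒱, imgDown f V ⊆ U}) :
    IsCoveringUniformity 𝒰 ∧
    (∀ V ∈ 𝒱, imgDown f V ∈ 𝒰) ∧
    (∀ 𝒰' : Set (Set A), IsCoveringUniformity 𝒰' →
      (∀ V ∈ 𝒱, imgDown f V ∈ 𝒰') → 𝒰 ⊆ 𝒰') := by
  subst h𝒰
  obtain ⟨⟨V₀, hV₀⟩, hcov, -, hinter, hstar⟩ := h𝒱
  have hmem : ∀ V ∈ 𝒱, imgDown f V ∈ {U | IsCoveringDownset U ∧ ∃ V ∈ 𝒱, imgDown f V ⊆ U} :=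
    fun V hV => ⟨(hcov V hV).imgDown f, V, hV, subset_rfl⟩
  refine ⟨⟨⟨_, hmem V₀ hV₀⟩, fun U hU => hU.1, ?_, ?_, ?_⟩, hmem, ?_⟩
  · rintro U ⟨-, V, hV, hVU⟩ U' hU' hUU'
    exact ⟨hU', V, hV, hVU.trans hUU'⟩
  · rintro U ⟨hU, V, hV, hVU⟩ U' ⟨hU', V', hV', hVU'⟩
    exact ⟨hU.inter hU', V ∩ V', hinter V hV V' hV', Set.subset_inter
      ((imgDown_mono f Set.inter_subset_left).trans hVU)
      ((imgDown_mono f Set.inter_subset_right).trans hVU')⟩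
  · rintro U ⟨-, V, hV, hVU⟩
    obtain ⟨W, hW, hWV⟩ := hstar V hV
    exact ⟨imgDown f W, hmem W hW,
      (starCover_imgDown_subset f W).trans ((imgDown_mono f hWV).trans hVU)⟩
  · rintro 𝒰' ⟨-, -, hup, -, -⟩ h U ⟨hU, V, hV, hVU⟩
    exact hup _ (h V hV) U hU hVU
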